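/- The mirabolic quantum Casimir element C_mir lies in the center of MU_v(2), i.e. C_mir commutes with every element of MU_v(2) (equivalently, with each of the generators e, f, k, k', ℓ). -/

import Mathlib

set_option synthInstance.maxHeartbeats 1000000
set_option maxHeartbeats 1000000

namespace MirabolicSL2

noncomputable section

/-- The base field `K = ℂ(v)`. -/
abbrev K : Type := RatFunc ℂ

/-- The variable `v ∈ ℂ(v)`. -/
def vv : K := RatFunc.X

/-- The quantum integer `[m] = (v^m - v^{-m})/(v - v⁻¹)`. -/
def qn (m : ℤ) : K := (vv ^ m - vv ^ (-m)) / (vv - vv⁻¹)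

/-- The five generators `e, f, k, k⁻¹, ℓ` of mirabolic quantum `sl₂`. -/
inductive G5 : Type | e | f | k | k' | l

open FreeAlgebra in
/-- The defining relations of mirabolic quantum `sl₂`. -/
inductive Rel : FreeAlgebra K G5 → FreeAlgebra K G5 → Prop
  | kk'  : Rel (ι K G5.k * ι K G5.k') 1
  | k'k  : Rel (ι K G5.k' * ι K G5.k) 1
  | kek' : Rel (ι K G5.k * ι K G5.e * ι K G5.k') ((vv ^ 2) • ι K G5.e)
  | kfk' : Rel (ι K G5.k * ι K G5.f * ι K G5.k') ((vv ^ (-2 : ℤ)) • ι K G5.f)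
  | effe : Rel (ι K G5.e * ι K G5.f - ι K G5.f * ι K G5.e)
      (((vv - vv⁻¹)⁻¹) • (ι K G5.k - ι K G5.k'))
  | ll   : Rel (ι K G5.l * ι K G5.l) (ι K G5.l)
  | kl   : Rel (ι K G5.k * ι K G5.l) (ι K G5.l * ι K G5.k)
  | lel  : Rel (ι K G5.l * ι K G5.e * ι K G5.l) (ι K G5.l * ι K G5.e)
  | lfl  : Rel (ι K G5.l * ι K G5.f * ι K G5.l) (ι K G5.f * ι K G5.l)
  | serreE : Rel ((vv + vv⁻¹) • (ι K G5.e * ι K G5.l * ι K G5.e))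
      (vv⁻¹ • (ι K G5.e * ι K G5.e * ι K G5.l) + vv • (ι K G5.l * (ι K G5.e * ι K G5.e)))
  | serreF : Rel ((vv + vv⁻¹) • (ι K G5.f * ι K G5.l * ι K G5.f))
      (vv⁻¹ • (ι K G5.l * (ι K G5.f * ι K G5.f)) + vv • (ι K G5.f * ι K G5.f * ι K G5.l))

/-- Mirabolic quantum `sl₂`: the unital `K`-algebra presented by the generators
`e, f, k, k⁻¹, ℓ` and the relations `Rel`. -/
abbrev MU2 : Type := RingQuot Rel

/-- The generator `e` of `MU_v(2)`. -/
def Ee : MU2 := RingQuot.mkAlgHom K Rel (FreeAlgebra.ι K G5.e)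
/-- The generator `f` of `MU_v(2)`. -/
def Ff : MU2 := RingQuot.mkAlgHom K Rel (FreeAlgebra.ι K G5.f)
/-- The generator `k` of `MU_v(2)`. -/
def Kk : MU2 := RingQuot.mkAlgHom K Rel (FreeAlgebra.ι K G5.k)
/-- The generator `k⁻¹` of `MU_v(2)`. -/
def Kk' : MU2 := RingQuot.mkAlgHom K Rel (FreeAlgebra.ι K G5.k')
/-- The generator `ℓ` of `MU_v(2)`. -/
def Ll : MU2 := RingQuot.mkAlgHom K Rel (FreeAlgebra.ι K G5.l)

/-- The mirabolic quantum Casimir element `C_mir` (Definition 5.9). -/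
def Cmir : MU2 :=
  (1 - vv ^ (-2 : ℤ)) •
      (Ff * Ee + (((vv - vv⁻¹) ^ 2)⁻¹) • (vv • Kk + vv⁻¹ • Kk'))
    - Ff * Ee * Ll - Ll * (Ff * Ee) + (vv ^ 2) • (Ff * Ll * Ee)
    + (vv ^ (-2 : ℤ)) • (Ee * Ll * Ff)
    + ((vv ^ 2 - 2) * ((vv - vv⁻¹) ^ 2)⁻¹) • (Ll * (vv • Kk + vv⁻¹ • Kk'))
    + (vv ^ (-2 : ℤ) * ((vv - vv⁻¹) ^ 2)⁻¹) • (Ll * (vv⁻¹ • Kk + vv • Kk'))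

section Presentation

variable {F A : Type*} [Field F] [Ring A] [Algebra F A]

/-- Elements of an `F`-algebra satisfying the relations of mirabolic quantum `sl₂` at `v`, with
the torus relations written as commutation rules. -/
structure IsMirabolic (v : F) (e f k k' l : A) : Prop where
  v_ne_zero : v ≠ 0
  sub_ne_zero : v ^ 2 - 1 ≠ 0
  ke : k * e = v ^ 2 • (e * k)
  kf : k * f = (v ^ 2)⁻¹ • (f * k)
  k'e : k' * e = (v ^ 2)⁻¹ • (e * k')
  k'f : k' * f = v ^ 2 • (f * k')
  ef : e * f = f * e + (v - v⁻¹)⁻¹ • (k - k')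
  kk' : k * k' = 1
  k'k : k' * k = 1
  ll : l * l = l
  kl : k * l = l * k
  k'l : k' * l = l * k'
  lel : l * e * l = l * e
  lfl : l * f * l = f * l
  serreE : (v + v⁻¹) • (e * l * e) = v⁻¹ • (e * e * l) + v • (l * (e * e))
  serreF : (v + v⁻¹) • (f * l * f) = v⁻¹ • (l * (f * f)) + v • (f * f * l)

/-- The mirabolic Casimir expression in arbitrary elements of an `F`-algebra. -/
def casimir (v : F) (e f k k' l : A) : A :=
  (1 - v ^ (-2 : ℤ)) •
      (f * e + (((v - v⁻¹) ^ 2)⁻¹) • (v • k + v⁻¹ • k'))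
    - f * e * l - l * (f * e) + (v ^ 2) • (f * l * e)
    + (v ^ (-2 : ℤ)) • (e * l * f)
    + ((v ^ 2 - 2) * ((v - v⁻¹) ^ 2)⁻¹) • (l * (v • k + v⁻¹ • k'))
    + (v ^ (-2 : ℤ) * ((v - v⁻¹) ^ 2)⁻¹) • (l * (v⁻¹ • k + v • k'))

/-- Left-multiplied form of a rewriting rule, for right-associated products. -/
theorem mul_mul_eq_of_eq {a b c : A} (h : a * b = c) (x : A) : a * (b * x) = c * x := by
  rw [← mul_assoc, h]

/-- Left-multiplied form of a rewriting rule for a triple product, for right-associated products. -/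
theorem mul_mul_mul_eq_of_eq {a b c d : A} (h : a * b * c = d) (x : A) :
    a * (b * (c * x)) = d * x := by
  rw [← h, mul_assoc, mul_assoc]

namespace IsMirabolic

variable {v : F} {e f k k' l : A}

theorem casimir_commute_e (h : IsMirabolic v e f k k' l) :
    Commute (casimir v e f k k' l) e := by
  have hv := h.v_ne_zero
  have hv' := h.sub_ne_zero
  have hleft := congrArg (f * ·) h.serreE
  have hright := congrArg (· * f) h.serreE
  simp only [Commute, SemiconjBy, casimir]
  simp only [h.ke, h.k'e, h.ef, h.kl, h.k'l, mul_mul_eq_of_eq h.ke, mul_mul_eq_of_eq h.k'e,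
    mul_mul_eq_of_eq h.ef, mul_mul_eq_of_eq h.kl, mul_mul_eq_of_eq h.k'l, one_mul, mul_assoc,
    mul_add, add_mul, mul_sub, sub_mul, smul_add, smul_sub, mul_smul_comm, smul_mul_assoc,
    smul_smul] at hleft hright ⊢
  linear_combination (norm := skip) (-v) • hleft + v⁻¹ • hright
  match_scalars <;> field_simp <;> ring

theorem casimir_commute_f (h : IsMirabolic v e f k k' l) :
    Commute (casimir v e f k k' l) f := by
  have hv := h.v_ne_zero
  have hv' := h.sub_ne_zero
  have hleft := congrArg (e * ·) h.serreF
  have hright := congrArg (· * e) h.serreF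
  simp only [Commute, SemiconjBy, casimir]
  simp only [h.kf, h.k'f, h.ef, h.kl, h.k'l, mul_mul_eq_of_eq h.kf, mul_mul_eq_of_eq h.k'f,
    mul_mul_eq_of_eq h.ef, mul_mul_eq_of_eq h.kl, mul_mul_eq_of_eq h.k'l, one_mul, mul_assoc,
    mul_add, add_mul, mul_sub, sub_mul, smul_add, smul_sub, mul_smul_comm, smul_mul_assoc,
    smul_smul] at hleft hright ⊢
  linear_combination (norm := skip) (-v⁻¹) • hleft + v • hright
  match_scalars <;> field_simp <;> ring

theorem casimir_commute_k (h : IsMirabolic v e f k k' l) :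
    Commute (casimir v e f k k' l) k := by
  have hv := h.v_ne_zero
  have hv' := h.sub_ne_zero
  simp only [Commute, SemiconjBy, casimir]
  simp only [h.kk', h.k'k, h.ke, h.kf, h.kl, mul_mul_eq_of_eq h.ke, mul_mul_eq_of_eq h.kf,
    mul_mul_eq_of_eq h.kl, one_mul, mul_one, mul_assoc, mul_add, add_mul, mul_sub, sub_mul,
    smul_add, mul_smul_comm, smul_mul_assoc, smul_smul]
  match_scalars <;> field_simp

theorem casimir_commute_k' (h : IsMirabolic v e f k k' l) :
    Commute (casimir v e f k k' l) k' := by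
  have hv := h.v_ne_zero
  have hv' := h.sub_ne_zero
  simp only [Commute, SemiconjBy, casimir]
  simp only [h.kk', h.k'k, h.k'e, h.k'f, h.k'l, mul_mul_eq_of_eq h.k'e, mul_mul_eq_of_eq h.k'f,
    mul_mul_eq_of_eq h.k'l, one_mul, mul_one, mul_assoc, mul_add, add_mul, mul_sub, sub_mul,
    smul_add, mul_smul_comm, smul_mul_assoc, smul_smul]
  match_scalars <;> field_simp

theorem casimir_commute_l (h : IsMirabolic v e f k k' l) :
    Commute (casimir v e f k k' l) l := by
  have hv := h.v_ne_zero
  have hv' := h.sub_ne_zero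
  have lel : l * (e * l) = l * e := by rw [← mul_assoc, h.lel]
  have lfl : l * (f * l) = f * l := by rw [← mul_assoc, h.lfl]
  simp only [Commute, SemiconjBy, casimir]
  simp only [h.ef, h.ll, h.kl, h.k'l, mul_mul_eq_of_eq h.ef, mul_mul_eq_of_eq h.ll, lel, lfl,
    mul_mul_mul_eq_of_eq h.lel, mul_mul_mul_eq_of_eq h.lfl, one_mul, mul_assoc, mul_add,
    add_mul, mul_sub, sub_mul, smul_add, smul_sub, mul_smul_comm, smul_mul_assoc, smul_smul]
  match_scalars <;> field_simp <;> ring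

end IsMirabolic

/-- Conjugation by `k` as a commutation rule for `k`. -/
theorem mul_eq_smul_mul_of_conj {c : F} {k k' x : A} (hk : k' * k = 1)
    (h : k * x * k' = c • x) : k * x = c • (x * k) := by
  rw [← smul_mul_assoc, ← h, mul_assoc (k * x), hk, mul_one]

/-- Conjugation by `k` as a commutation rule for its inverse `k'`. -/
theorem inv_mul_eq_smul_mul_of_conj {c : F} {k k' x : A} (hc : c ≠ 0) (hk : k' * k = 1)
    (h : k * x * k' = c • x) : k' * x = c⁻¹ • (x * k') := by
  rw [eq_inv_smul_iff₀ hc, ← mul_smul_comm, ← h, ← mul_assoc, ← mul_assoc, hk, one_mul]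

end Presentation

theorem vv_ne_zero : vv ≠ 0 := RatFunc.X_ne_zero

theorem vv_sq_sub_one_ne_zero : vv ^ 2 - 1 ≠ 0 := by
  have h : (Polynomial.X ^ 2 - 1 : Polynomial ℂ) ≠ 0 :=
    Polynomial.X_pow_sub_C_ne_zero two_pos 1
  simpa [vv] using RatFunc.algebraMap_ne_zero h

theorem isMirabolic : IsMirabolic vv Ee Ff Kk Kk' Ll := by
  have kk' : Kk * Kk' = 1 := by
    simpa only [Kk, Kk', map_mul, map_one] using RingQuot.mkAlgHom_rel K Rel.kk'
  have k'k : Kk' * Kk = 1 := by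
    simpa only [Kk, Kk', map_mul, map_one] using RingQuot.mkAlgHom_rel K Rel.k'k
  have kek' : Kk * Ee * Kk' = vv ^ 2 • Ee := by
    simpa only [Ee, Kk, Kk', map_mul, map_smul] using RingQuot.mkAlgHom_rel K Rel.kek'
  have kfk' : Kk * Ff * Kk' = (vv ^ 2)⁻¹ • Ff := by
    rw [show (vv ^ 2)⁻¹ = vv ^ (-2 : ℤ) from (zpow_neg vv 2).symm]
    simpa only [Ff, Kk, Kk', map_mul, map_smul] using RingQuot.mkAlgHom_rel K Rel.kfk'
  have ef : Ee * Ff - Ff * Ee = (vv - vv⁻¹)⁻¹ • (Kk - Kk') := by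
    simpa only [Ee, Ff, Kk, Kk', map_mul, map_smul, map_sub] using RingQuot.mkAlgHom_rel K Rel.effe
  have kl : Kk * Ll = Ll * Kk := by
    simpa only [Kk, Ll, map_mul] using RingQuot.mkAlgHom_rel K Rel.kl
  have hsq : vv ^ 2 ≠ 0 := pow_ne_zero 2 vv_ne_zero
  exact {
    v_ne_zero := vv_ne_zero
    sub_ne_zero := vv_sq_sub_one_ne_zero
    ke := mul_eq_smul_mul_of_conj k'k kek'
    kf := mul_eq_smul_mul_of_conj k'k kfk'
    k'e := inv_mul_eq_smul_mul_of_conj hsq k'k kek'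
    k'f := by simpa only [inv_inv] using inv_mul_eq_smul_mul_of_conj (inv_ne_zero hsq) k'k kfk'
    ef := by rw [← ef, add_sub_cancel]
    kk' := kk'
    k'k := k'k
    ll := by simpa only [Ll, map_mul] using RingQuot.mkAlgHom_rel K Rel.ll
    kl := kl
    k'l := by
      have h : Kk * Ll * Kk' = (1 : K) • Ll := by rw [kl, mul_assoc, kk', mul_one, one_smul]
      simpa only [inv_one, one_smul] using inv_mul_eq_smul_mul_of_conj (F := K) one_ne_zero k'k h
    lel := by simpa only [Ee, Ll, map_mul] using RingQuot.mkAlgHom_rel K Rel.lel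
    lfl := by simpa only [Ff, Ll, map_mul] using RingQuot.mkAlgHom_rel K Rel.lfl
    serreE := by
      simpa only [Ee, Ll, map_mul, map_smul, map_add] using RingQuot.mkAlgHom_rel K Rel.serreE
    serreF := by
      simpa only [Ff, Ll, map_mul, map_smul, map_add] using RingQuot.mkAlgHom_rel K Rel.serreF }

/-- Proposition 5.10: the mirabolic quantum Casimir element is central in `MU_v(2)`. -/
theorem casimir_central : ∀ x : MU2, Cmir * x = x * Cmir := by
  intro x
  obtain ⟨y, rfl⟩ := RingQuot.mkAlgHom_surjective K Rel x
  change Commute Cmir _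
  induction y with
  | grade0 r => rw [AlgHom.commutes]; exact (Algebra.commutes r Cmir).symm
  | grade1 g =>
    cases g
    · exact isMirabolic.casimir_commute_e
    · exact isMirabolic.casimir_commute_f
    · exact isMirabolic.casimir_commute_k
    · exact isMirabolic.casimir_commute_k'
    · exact isMirabolic.casimir_commute_l
  | mul a b ha hb => rw [map_mul]; exact ha.mul_right hb
  | add a b ha hb => rw [map_add]; exact ha.add_right hb

end

end MirabolicSL2
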